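/- Let ω ≥ 1 and λ ≥ 0. Then ∫_0^∞ (1 − e^{−λ s}) s^{−1} e^{−ω s} I_0(s) ds = log( (ω + λ + √((ω+λ)^2 − 1)) / (ω + √(ω^2 − 1)) ), where I_0(s) = Σ_{m=0}^∞ (s/2)^{2m}/(m!)^2. -/

import Mathlib

open MeasureTheory Set

/-- The modified Bessel function of the first kind of order 0,
`I₀(s) = Σ_{m=0}^∞ (s/2)^{2m} / (m!)²`. -/
noncomputable def besselI0 (s : ℝ) : ℝ :=
  ∑' m : ℕ, (s / 2) ^ (2 * m) / ((Nat.factorial m : ℝ)) ^ 2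

theorem Ring.choose_neg_half_eq_centralBinom (n : ℕ) :
    Ring.choose (-1 / 2 : ℝ) n = (-1) ^ n * n.centralBinom / 4 ^ n := by
  have key : (descPochhammer ℤ n).smeval (-1 / 2 : ℝ)
      = n.factorial * ((-1) ^ n * n.centralBinom / 4 ^ n) := by
    induction n with
    | zero => simp
    | succ n ih =>
      have hc : ((n : ℝ) + 1) * (n + 1).centralBinom = 2 * (2 * n + 1) * n.centralBinom := by
        exact_mod_cast Nat.succ_mul_centralBinom_succ n
      have h1 : (descPochhammer ℤ (n + 1)).smeval (-1 / 2 : ℝ)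
          = (descPochhammer ℤ n).smeval (-1 / 2 : ℝ) * (-1 / 2 - n) := by
        simp [descPochhammer_succ_right, Polynomial.smeval_mul, Polynomial.smeval_natCast]
      rw [h1, ih, Nat.factorial_succ]
      push_cast
      rw [show ((n : ℝ) + 1) * n.factorial * ((-1) ^ (n + 1) * (n + 1).centralBinom / 4 ^ (n + 1))
        = n.factorial * ((-1) ^ (n + 1) * (((n : ℝ) + 1) * (n + 1).centralBinom) / 4 ^ (n + 1))
        by ring, hc]
      field_simp
      ring
  rw [Ring.choose_eq_smul, key, smul_eq_mul, inv_mul_cancel_left₀]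
  exact_mod_cast n.factorial_ne_zero

/-- The generating function of the central binomial coefficients. -/
theorem hasSum_centralBinom_div_four_pow_mul_pow {t : ℝ} (ht : |t| < 1) :
    HasSum (fun n : ℕ ↦ (n.centralBinom : ℝ) / 4 ^ n * t ^ n) (√(1 - t))⁻¹ := by
  have h := (Real.one_add_rpow_hasFPowerSeriesOnBall_zero (a := -1 / 2)).hasSum (y := -t)
    (by simpa [enorm_eq_nnnorm, ← NNReal.coe_lt_coe] using ht)
  have h1 : 0 ≤ 1 - t := by linarith [(abs_lt.1 ht).2]
  convert! h using 1
  · funext n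
    rw [binomialSeries_apply, Ring.choose_neg_half_eq_centralBinom]
    simp only [List.ofFn_const, List.prod_replicate, smul_eq_mul]
    rw [neg_pow t]
    have : ((-1 : ℝ) ^ n) * (-1) ^ n = 1 := by rw [← mul_pow]; simp
    linear_combination (-(n.centralBinom : ℝ) / 4 ^ n * t ^ n) * this
  · rw [zero_add, ← sub_eq_add_neg, Real.sqrt_eq_rpow, ← Real.rpow_neg h1]
    norm_num

theorem hasSum_factorial_two_mul_div {x : ℝ} (hx : 1 < x) :
    HasSum (fun m : ℕ ↦ ((2 * m).factorial : ℝ) / x ^ (2 * m + 1) / (4 ^ m * (m.factorial : ℝ) ^ 2))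
      (√(x ^ 2 - 1))⁻¹ := by
  have hx0 : 0 < x := by linarith
  have ht : |(x⁻¹) ^ 2| < 1 := by
    rw [abs_of_nonneg (by positivity)]
    exact pow_lt_one₀ (by positivity) (inv_lt_one_of_one_lt₀ hx) two_ne_zero
  convert! (hasSum_centralBinom_div_four_pow_mul_pow ht).mul_left x⁻¹ using 1
  · funext m
    have h : ((2 * m).factorial : ℝ) = m.centralBinom * (m.factorial : ℝ) ^ 2 := by
      have := Nat.choose_mul_factorial_mul_factorial (show m ≤ 2 * m by lia)
      rw [show 2 * m - m = m by lia, ← Nat.centralBinom_eq_two_mul_choose] at this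
      rw [← this]
      push_cast
      ring
    rw [h, ← pow_mul, inv_pow]
    field_simp
    ring
  · rw [← mul_inv, show x ^ 2 - 1 = x ^ 2 * (1 - x⁻¹ ^ 2) by field_simp,
      Real.sqrt_mul (by positivity), Real.sqrt_sq hx0.le]

theorem lintegral_pow_mul_exp_neg_mul_Ioi (n : ℕ) {x : ℝ} (hx : 0 < x) :
    ∫⁻ s in Ioi (0 : ℝ), ENNReal.ofReal (s ^ n * Real.exp (-(x * s)))
      = ENNReal.ofReal (n.factorial / x ^ (n + 1)) := by
  have key : ∫ s in Ioi (0 : ℝ), s ^ n * Real.exp (-(x * s)) = n.factorial / x ^ (n + 1) := by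
    have h := Real.integral_rpow_mul_exp_neg_mul_Ioi (a := n + 1) (by positivity) hx
    simp only [add_sub_cancel_right, Real.rpow_natCast, Real.Gamma_nat_eq_factorial] at h
    rw [h]
    norm_cast
    rw [one_div, inv_pow, div_eq_inv_mul]
  rw [← key, ofReal_integral_eq_lintegral_ofReal]
  · exact .of_integral_ne_zero (by rw [key]; positivity)
  · filter_upwards [ae_restrict_mem measurableSet_Ioi] with s (hs : 0 < s)
    positivity

theorem hasSum_besselI0 (s : ℝ) :
    HasSum (fun m : ℕ ↦ (s / 2) ^ (2 * m) / (m.factorial : ℝ) ^ 2) (besselI0 s) := by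
  suffices h : Summable fun m : ℕ ↦ (s / 2) ^ (2 * m) / (m.factorial : ℝ) ^ 2 from h.hasSum
  refine .of_nonneg_of_le (fun m ↦ ?_) (fun m ↦ ?_)
    (Real.summable_pow_div_factorial ((s / 2) ^ 2))
  · rw [pow_mul]; positivity
  · rw [pow_mul]
    have : (1 : ℝ) ≤ m.factorial := by exact_mod_cast m.factorial_pos
    gcongr
    nlinarith

theorem measurable_besselI0 : Measurable besselI0 :=
  measurable_of_tendsto_metrizable
    (f := fun n s ↦ ∑ m ∈ Finset.range n, (s / 2) ^ (2 * m) / (m.factorial : ℝ) ^ 2)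
    (fun n ↦ by fun_prop) (tendsto_pi_nhds.2 fun s ↦ (hasSum_besselI0 s).tendsto_sum_nat)

theorem besselI0_nonneg (s : ℝ) : 0 ≤ besselI0 s :=
  (hasSum_besselI0 s).nonneg fun m ↦ by rw [pow_mul]; positivity

/-- The Laplace transform of `besselI0`. -/
theorem lintegral_exp_neg_mul_besselI0 {x : ℝ} (hx : 1 < x) :
    ∫⁻ s in Ioi (0 : ℝ), ENNReal.ofReal (Real.exp (-(x * s)) * besselI0 s)
      = ENNReal.ofReal (√(x ^ 2 - 1))⁻¹ := by
  have hx0 : 0 < x := by linarith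
  have h : ∀ s ∈ Ioi (0 : ℝ), ENNReal.ofReal (Real.exp (-(x * s)) * besselI0 s)
      = ∑' m : ℕ, ENNReal.ofReal (s ^ (2 * m) * Real.exp (-(x * s)))
        * ENNReal.ofReal (4 ^ m * (m.factorial : ℝ) ^ 2)⁻¹ := by
    intro s (hs : 0 < s)
    have hsum := (hasSum_besselI0 s).mul_left (Real.exp (-(x * s)))
    rw [← hsum.tsum_eq, ENNReal.ofReal_tsum_of_nonneg (fun m ↦ by positivity) hsum.summable]
    refine tsum_congr fun m ↦ ?_
    rw [← ENNReal.ofReal_mul (by positivity), div_pow, pow_mul 2]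
    congr 1
    norm_num
    field_simp
  rw [setLIntegral_congr_fun measurableSet_Ioi h, lintegral_tsum fun m ↦ by fun_prop]
  have hsum := hasSum_factorial_two_mul_div hx
  rw [← hsum.tsum_eq, ENNReal.ofReal_tsum_of_nonneg (fun m ↦ by positivity) hsum.summable]
  refine tsum_congr fun m ↦ ?_
  rw [lintegral_mul_const _ (by fun_prop), lintegral_pow_mul_exp_neg_mul_Ioi _ hx0,
    ← ENNReal.ofReal_mul (by positivity), ← div_eq_mul_inv]

theorem lintegral_exp_neg_mul_Ioc {a b s : ℝ} (hab : a ≤ b) (hs : 0 < s) :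
    ∫⁻ x in Ioc a b, ENNReal.ofReal (Real.exp (-(x * s)))
      = ENNReal.ofReal ((Real.exp (-(a * s)) - Real.exp (-(b * s))) * s⁻¹) := by
  have hc : Continuous fun x : ℝ ↦ Real.exp (-(x * s)) := by fun_prop
  have hd (x : ℝ) : HasDerivAt (fun x ↦ -(Real.exp (-(x * s)) * s⁻¹)) (Real.exp (-(x * s))) x := by
    convert! ((((hasDerivAt_id x).mul_const s).neg.exp).mul_const s⁻¹).neg using 1
    simp [hs.ne']
  rw [← ofReal_integral_eq_lintegral_ofReal hc.integrableOn_Ioc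
      (.of_forall fun x ↦ (Real.exp_pos _).le), ← intervalIntegral.integral_of_le hab,
    intervalIntegral.integral_eq_sub_of_hasDerivAt (fun x _ ↦ hd x) (hc.intervalIntegrable _ _)]
  congr 1
  ring

theorem lintegral_inv_sqrt_sq_sub_one {a b : ℝ} (ha : 1 ≤ a) (hab : a ≤ b) :
    ∫⁻ x in Ioc a b, ENNReal.ofReal (√(x ^ 2 - 1))⁻¹
      = ENNReal.ofReal (Real.arcosh b - Real.arcosh a) := by
  have hc : ContinuousOn Real.arcosh (Icc a b) :=
    Real.continuousOn_arcosh.mono fun x hx ↦ ha.trans hx.1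
  have hd : ∀ x ∈ Ioo a b, HasDerivAt Real.arcosh (√(x ^ 2 - 1))⁻¹ x :=
    fun x hx ↦ Real.hasDerivAt_arcosh (ha.trans_lt hx.1)
  have hi := intervalIntegral.integrableOn_deriv_of_nonneg hc hd fun x _ ↦ by positivity
  rw [← ofReal_integral_eq_lintegral_ofReal hi (.of_forall fun x ↦ by positivity),
    ← intervalIntegral.integral_of_le hab,
    intervalIntegral.integral_eq_sub_of_hasDerivAt_of_le hab hc hd
      ((intervalIntegrable_iff_integrableOn_Ioc_of_le hab).2 hi)]

/-- The Laplace exponent of the Bessel intensity: for `ω ≥ 1` and `λ ≥ 0`,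
`∫₀^∞ (1 - e^{-λs}) s⁻¹ e^{-ωs} I₀(s) ds
  = log((ω + λ + √((ω+λ)² - 1)) / (ω + √(ω² - 1)))`. -/
theorem besselIntensity_laplace_exponent (ω lam : ℝ) (hω : 1 ≤ ω) (hlam : 0 ≤ lam) :
    ∫ s in Set.Ioi (0:ℝ),
        (1 - Real.exp (-lam * s)) * (s⁻¹ * Real.exp (-ω * s) * besselI0 s)
      = Real.log ((ω + lam + Real.sqrt ((ω + lam) ^ 2 - 1)) /
          (ω + Real.sqrt (ω ^ 2 - 1))) := by
  have hab : ω ≤ ω + lam := by linarith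
  have hmeas := measurable_besselI0
  have hinner : ∀ s ∈ Ioi (0 : ℝ), ENNReal.ofReal
      ((1 - Real.exp (-lam * s)) * (s⁻¹ * Real.exp (-ω * s) * besselI0 s))
      = ∫⁻ x in Ioc ω (ω + lam), ENNReal.ofReal (Real.exp (-(x * s)) * besselI0 s) := by
    intro s hs
    simp_rw [ENNReal.ofReal_mul (Real.exp_pos _).le]
    rw [lintegral_mul_const _ (by fun_prop), lintegral_exp_neg_mul_Ioc hab hs,
      ← ENNReal.ofReal_mul' (besselI0_nonneg s), add_mul, neg_add, Real.exp_add]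
    congr 1
    ring_nf
  have hlint : ∫⁻ s in Ioi (0 : ℝ), ENNReal.ofReal
      ((1 - Real.exp (-lam * s)) * (s⁻¹ * Real.exp (-ω * s) * besselI0 s))
      = ENNReal.ofReal (Real.arcosh (ω + lam) - Real.arcosh ω) := by
    rw [setLIntegral_congr_fun measurableSet_Ioi hinner,
      lintegral_lintegral_swap (Measurable.aemeasurable (by fun_prop)),
      ← lintegral_inv_sqrt_sq_sub_one hω hab]
    exact setLIntegral_congr_fun measurableSet_Ioc fun x hx ↦
      lintegral_exp_neg_mul_besselI0 (hω.trans_lt hx.1)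
  have hnn : 0 ≤ᵐ[volume.restrict (Ioi (0 : ℝ))] fun s ↦
      (1 - Real.exp (-lam * s)) * (s⁻¹ * Real.exp (-ω * s) * besselI0 s) := by
    filter_upwards [ae_restrict_mem measurableSet_Ioi] with s (hs : 0 < s)
    have h1 : Real.exp (-lam * s) ≤ 1 := Real.exp_le_one_iff.2 (by nlinarith)
    have h2 := besselI0_nonneg s
    exact mul_nonneg (sub_nonneg.2 h1) (by positivity)
  rw [integral_eq_lintegral_of_nonneg_ae hnn (Measurable.aestronglyMeasurable (by fun_prop)), hlint,
    ENNReal.toReal_ofReal (sub_nonneg.2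
      ((Real.arcosh_le_arcosh (by linarith) (by linarith)).2 hab)),
    Real.log_div (by positivity) (by positivity), Real.arcosh, Real.arcosh]
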